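/- Let N ≥ 1, let a ∈ (0, N), let f : (0,1] → [0,∞) be increasing with f(1) < ∞, and let μ be a nonnegative measurable function on R^N with μ(x) ≤ |x|^{-a} f(|x|) for |x| ≤ 1 and μ(x) = 0 for |x| > 1. Then for any r_* > N/a there exist C > 0 and t_0 ∈ (0,1) such that for all 0 < t < t_0, the L^{r_*}-norm of S(t)μ over the annulus B(0,1) \ B(0,√t) is at most C t^{-(N/2)(a/N - 1/r_*)} (f(t^{1/6}) + t^{(a r_* - N)/(4 r_*)}). -/

import Mathlib

open MeasureTheory

/-- The heat semigroup applied to a nonnegative function on `R^N`. -/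
noncomputable def heatSemigroup (N : ℕ) (t : ℝ) (μ : EuclideanSpace ℝ (Fin N) → ℝ)
    (x : EuclideanSpace ℝ (Fin N)) : ℝ :=
  ∫ y, (4 * Real.pi * t) ^ (-(N : ℝ) / 2) * Real.exp (-‖x - y‖ ^ 2 / (4 * t)) * μ y

/-- The Gaussian heat kernel on `R^N`. -/
noncomputable def heatKernel (N : ℕ) (t : ℝ) (z : EuclideanSpace ℝ (Fin N)) : ℝ :=
  (4 * Real.pi * t) ^ (-(N : ℝ) / 2) * Real.exp (-‖z‖ ^ 2 / (4 * t))

lemma heatKernel_nonneg (N : ℕ) {t : ℝ} (ht : 0 < t) (z : EuclideanSpace ℝ (Fin N)) :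
    0 ≤ heatKernel N t z := by
  unfold heatKernel; positivity

lemma integral_heatKernel (N : ℕ) {t : ℝ} (ht : 0 < t) : ∫ z, heatKernel N t z = 1 := by
  have h4 : 0 < 4 * Real.pi * t := by positivity
  have h := GaussianFourier.integral_rexp_neg_mul_sq_norm (V := EuclideanSpace ℝ (Fin N))
    (b := 1 / (4 * t)) (by positivity)
  have he : ∀ z : EuclideanSpace ℝ (Fin N), heatKernel N t z =
      (4 * Real.pi * t) ^ (-(N : ℝ) / 2) * Real.exp (-(1 / (4 * t)) * ‖z‖ ^ 2) := by
    intro z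
    unfold heatKernel
    congr 2
    ring
  simp_rw [he]
  rw [integral_const_mul, h, finrank_euclideanSpace_fin,
    show Real.pi / (1 / (4 * t)) = 4 * Real.pi * t by field_simp, ← Real.rpow_add h4]
  rw [show -(N : ℝ) / 2 + N / 2 = 0 by ring, Real.rpow_zero]

lemma integrable_heatKernel (N : ℕ) {t : ℝ} (ht : 0 < t) : Integrable (heatKernel N t) :=
  .of_integral_ne_zero (by rw [integral_heatKernel N ht]; exact one_ne_zero)

lemma rpow_mul_exp_neg_le {p c s : ℝ} (hp : 0 < p) (hc : 0 < c) (hs : 0 ≤ s) :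
    s ^ p * Real.exp (-(c * s)) ≤ (p / c) ^ p := by
  have h1 : s * c / p ≤ Real.exp (c * s / p) := by
    rw [mul_comm s c]
    linarith [Real.add_one_le_exp (c * s / p)]
  have h2 : s ≤ p / c * Real.exp (c * s / p) := by
    calc s = p / c * (s * c / p) := by field_simp
      _ ≤ _ := by gcongr
  calc s ^ p * Real.exp (-(c * s))
      ≤ (p / c * Real.exp (c * s / p)) ^ p * Real.exp (-(c * s)) := by gcongr
    _ = (p / c) ^ p := by
      rw [Real.mul_rpow (by positivity) (by positivity), ← Real.exp_mul,
        mul_assoc, ← Real.exp_add]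
      rw [show c * s / p * p + -(c * s) = 0 by field_simp; ring, Real.exp_zero, mul_one]

lemma pow_pred_mul_rpow_neg {N : ℕ} (hN : 1 ≤ N) {a s : ℝ} (hs : 0 < s) :
    s ^ (N - 1) * s ^ (-a) = s ^ ((N : ℝ) - a - 1) := by
  rw [← Real.rpow_natCast, ← Real.rpow_add hs, Nat.cast_sub hN]
  congr 1
  push_cast
  ring

lemma nontrivial_euclideanSpace_fin {N : ℕ} (hN : 1 ≤ N) :
    Nontrivial (EuclideanSpace ℝ (Fin N)) :=
  Module.nontrivial_of_finrank_pos (R := ℝ) (by rw [finrank_euclideanSpace_fin]; omega)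

/-- Integrability and scaling of `‖y‖ ^ (-a)` over balls, below the critical exponent. -/
lemma exists_integral_ball_norm_rpow_neg {N : ℕ} (hN : 1 ≤ N) {a : ℝ} (haN : a < N) :
    ∃ C > 0, ∀ R : ℝ, 0 < R →
      Integrable (fun y : EuclideanSpace ℝ (Fin N) ↦
        (Set.Iio R).indicator (fun s : ℝ ↦ s ^ (-a)) ‖y‖) ∧
      ∫ y : EuclideanSpace ℝ (Fin N), (Set.Iio R).indicator (fun s : ℝ ↦ s ^ (-a)) ‖y‖
        ≤ C * R ^ ((N : ℝ) - a) := by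
  have := nontrivial_euclideanSpace_fin hN
  have hNa : 0 < (N : ℝ) - a := by linarith
  set v := (volume : Measure (EuclideanSpace ℝ (Fin N))).real (Metric.ball 0 1)
  have hv : 0 ≤ v := measureReal_nonneg
  refine ⟨N * v / (N - a) + 1, by positivity, fun R hR ↦ ?_⟩
  have hcongr : ∀ s ∈ Set.Ioi (0 : ℝ),
      s ^ (N - 1) • (Set.Iio R).indicator (fun s : ℝ ↦ s ^ (-a)) s =
        (Set.Ioo 0 R).indicator (fun s ↦ s ^ ((N : ℝ) - a - 1)) s := by
    intro s hs
    have hs : 0 < s := hs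
    by_cases h : s < R <;> simp [h, hs, pow_pred_mul_rpow_neg hN]
  constructor
  · rw [integrable_fun_norm_addHaar volume (f := (Set.Iio R).indicator (fun s : ℝ ↦ s ^ (-a))),
      finrank_euclideanSpace_fin, integrableOn_congr_fun hcongr measurableSet_Ioi]
    apply Integrable.integrableOn
    rw [integrable_indicator_iff measurableSet_Ioo, intervalIntegral.integrableOn_Ioo_rpow_iff hR]
    linarith
  · rw [integral_fun_norm_addHaar volume ((Set.Iio R).indicator (fun s : ℝ ↦ s ^ (-a))),
      finrank_euclideanSpace_fin, setIntegral_congr_fun measurableSet_Ioi hcongr,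
      setIntegral_indicator measurableSet_Ioo,
      Set.inter_eq_right.mpr Set.Ioo_subset_Ioi_self, ← integral_Ioc_eq_integral_Ioo,
      ← intervalIntegral.integral_of_le hR.le, integral_rpow (Or.inl (by linarith))]
    have : 0 < R ^ ((N : ℝ) - a) := by positivity
    rw [sub_add_cancel, Real.zero_rpow hNa.ne', sub_zero, nsmul_eq_mul, smul_eq_mul]
    calc (N : ℝ) * (v * (R ^ ((N : ℝ) - a) / (N - a)))
        = N * v / (N - a) * R ^ ((N : ℝ) - a) := by ring
      _ ≤ _ := by gcongr; linarith

/-- Integrability and scaling of `‖y‖ ^ (-b)` outside balls, above the critical exponent. -/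
lemma exists_integral_compl_ball_norm_rpow_neg {N : ℕ} (hN : 1 ≤ N) {b : ℝ} (hb : N < b) :
    ∃ C > 0, ∀ R : ℝ, 0 < R →
      Integrable (fun y : EuclideanSpace ℝ (Fin N) ↦
        (Set.Ici R).indicator (fun s : ℝ ↦ s ^ (-b)) ‖y‖) ∧
      ∫ y : EuclideanSpace ℝ (Fin N), (Set.Ici R).indicator (fun s : ℝ ↦ s ^ (-b)) ‖y‖
        ≤ C * R ^ ((N : ℝ) - b) := by
  have := nontrivial_euclideanSpace_fin hN
  have hNb : 0 < b - (N : ℝ) := by linarith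
  set v := (volume : Measure (EuclideanSpace ℝ (Fin N))).real (Metric.ball 0 1)
  have hv : 0 ≤ v := measureReal_nonneg
  refine ⟨N * v / (b - N) + 1, by positivity, fun R hR ↦ ?_⟩
  have hcongr : ∀ s ∈ Set.Ioi (0 : ℝ),
      s ^ (N - 1) • (Set.Ici R).indicator (fun s : ℝ ↦ s ^ (-b)) s =
        (Set.Ici R).indicator (fun s ↦ s ^ ((N : ℝ) - b - 1)) s := by
    intro s hs
    have hs : 0 < s := hs
    by_cases h : R ≤ s <;> simp [h, pow_pred_mul_rpow_neg hN hs]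
  constructor
  · rw [integrable_fun_norm_addHaar volume (f := (Set.Ici R).indicator (fun s : ℝ ↦ s ^ (-b))),
      finrank_euclideanSpace_fin, integrableOn_congr_fun hcongr measurableSet_Ioi]
    apply Integrable.integrableOn
    rw [integrable_indicator_iff measurableSet_Ici, integrableOn_Ici_iff_integrableOn_Ioi]
    exact integrableOn_Ioi_rpow_of_lt (by linarith) hR
  · rw [integral_fun_norm_addHaar volume ((Set.Ici R).indicator (fun s : ℝ ↦ s ^ (-b))),
      finrank_euclideanSpace_fin, setIntegral_congr_fun measurableSet_Ioi hcongr,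
      setIntegral_indicator measurableSet_Ici,
      Set.inter_eq_right.mpr (Set.Ici_subset_Ioi.mpr hR), integral_Ici_eq_integral_Ioi,
      integral_Ioi_rpow_of_lt (by linarith) hR]
    have : 0 < R ^ ((N : ℝ) - b) := by positivity
    rw [sub_add_cancel, nsmul_eq_mul, smul_eq_mul, ← neg_div_neg_eq, neg_neg, neg_sub]
    calc (N : ℝ) * (v * (R ^ ((N : ℝ) - b) / (b - N)))
        = N * v / (b - N) * R ^ ((N : ℝ) - b) := by ring
      _ ≤ _ := by gcongr; linarith

/-- The heat semigroup preserves the size of `‖y‖ ^ (-a)`. -/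
lemma exists_integral_heatKernel_mul_norm_rpow_neg_le {N : ℕ} (hN : 1 ≤ N) {a : ℝ} (ha : 0 < a)
    (haN : a < N) :
    ∃ C > 0, ∀ t : ℝ, 0 < t → ∀ x : EuclideanSpace ℝ (Fin N), x ≠ 0 →
      Integrable (fun y ↦ heatKernel N t (x - y) * ‖y‖ ^ (-a)) ∧
      ∫ y, heatKernel N t (x - y) * ‖y‖ ^ (-a) ≤ C * ‖x‖ ^ (-a) := by
  obtain ⟨B, hB, hball⟩ := exists_integral_ball_norm_rpow_neg hN haN
  have hN0 : (0 : ℝ) < N / 2 := by positivity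
  set E : ℝ := ((N : ℝ) / 2 / (1 / 16)) ^ ((N : ℝ) / 2)
  set P : ℝ := (4 * Real.pi) ^ (-(N : ℝ) / 2)
  refine ⟨2 ^ a + P * E * B, by positivity, fun t ht x hx ↦ ?_⟩
  have hx : 0 < ‖x‖ := norm_pos_iff.mpr hx
  obtain ⟨hint, hle⟩ := hball ‖x‖ hx
  set φ := (Set.Iio ‖x‖).indicator (fun s : ℝ ↦ s ^ (-a))
  set k : ℝ := (4 * Real.pi * t) ^ (-(N : ℝ) / 2) * Real.exp (-‖x‖ ^ 2 / (16 * t))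
  have hk : 0 ≤ k := by positivity
  have hφ : ∀ y : EuclideanSpace ℝ (Fin N), 0 ≤ φ ‖y‖ := fun y ↦
    Set.indicator_apply_nonneg fun _ ↦ by positivity
  have hG := (integrable_heatKernel N ht).comp_sub_left x
  have hbound : ∀ y, heatKernel N t (x - y) * ‖y‖ ^ (-a) ≤
      2 ^ a * ‖x‖ ^ (-a) * heatKernel N t (x - y) + k * φ ‖y‖ := by
    intro y
    have hGy := heatKernel_nonneg N ht (x - y)
    rcases le_or_gt (‖x‖ / 2) ‖y‖ with h | h
    · have h1 : ‖y‖ ^ (-a) ≤ 2 ^ a * ‖x‖ ^ (-a) := by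
        calc ‖y‖ ^ (-a) ≤ (‖x‖ / 2) ^ (-a) :=
              Real.rpow_le_rpow_of_nonpos (by positivity) h (by linarith)
          _ = 2 ^ a * ‖x‖ ^ (-a) := by
            rw [Real.div_rpow hx.le (by norm_num), Real.rpow_neg (by norm_num : (0 : ℝ) ≤ 2)]
            field_simp
      have := mul_le_mul_of_nonneg_left h1 hGy
      have := mul_nonneg hk (hφ y)
      linarith
    · have h1 : φ ‖y‖ = ‖y‖ ^ (-a) := Set.indicator_of_mem (by simp; linarith) _
      have h2 : heatKernel N t (x - y) ≤ k := by
        have h3 : ‖x‖ / 2 ≤ ‖x - y‖ := by linarith [norm_sub_norm_le x y]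
        have h4 : -‖x - y‖ ^ 2 / (4 * t) ≤ -‖x‖ ^ 2 / (16 * t) := by
          rw [div_le_div_iff₀ (by positivity) (by positivity)]
          have : (‖x‖ / 2) ^ 2 ≤ ‖x - y‖ ^ 2 := by gcongr
          nlinarith
        simp only [heatKernel, k]
        gcongr
      rw [h1]
      have : heatKernel N t (x - y) * ‖y‖ ^ (-a) ≤ k * ‖y‖ ^ (-a) := by gcongr
      have : 0 ≤ 2 ^ a * ‖x‖ ^ (-a) * heatKernel N t (x - y) := by positivity
      linarith
  have hnn : ∀ y, 0 ≤ heatKernel N t (x - y) * ‖y‖ ^ (-a) := fun y ↦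
    mul_nonneg (heatKernel_nonneg N ht _) (by positivity)
  have hdom := (hG.const_mul (2 ^ a * ‖x‖ ^ (-a))).add (hint.const_mul k)
  refine ⟨hdom.mono' ?_ (.of_forall fun y ↦ ?_), ?_⟩
  · unfold heatKernel
    exact (by fun_prop : Measurable _).aestronglyMeasurable
  · rw [Real.norm_of_nonneg (hnn y)]
    exact hbound y
  · have hkx : k * ‖x‖ ^ ((N : ℝ) - a) ≤ P * E * ‖x‖ ^ (-a) := by
      have h1 := rpow_mul_exp_neg_le (c := 1 / 16) (s := ‖x‖ ^ 2 / t) hN0 (by norm_num)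
        (by positivity)
      have h2 : k * ‖x‖ ^ ((N : ℝ) - a) = P * ((‖x‖ ^ 2 / t) ^ ((N : ℝ) / 2) *
          Real.exp (-(1 / 16 * (‖x‖ ^ 2 / t)))) * ‖x‖ ^ (-a) := by
        simp only [k, P]
        rw [Real.mul_rpow (by positivity) ht.le, Real.div_rpow (by positivity) ht.le,
          ← Real.rpow_natCast, ← Real.rpow_mul hx.le, sub_eq_add_neg, Real.rpow_add hx,
          neg_div, Real.rpow_neg ht.le]
        rw [show ((2 : ℕ) : ℝ) * (N / 2) = N by push_cast; ring]
        rw [show -‖x‖ ^ ((2 : ℕ) : ℝ) / (16 * t) = -(1 / 16 * (‖x‖ ^ ((2 : ℕ) : ℝ) / t)) by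
          field_simp]
        field_simp
      rw [h2]
      gcongr
    calc ∫ y, heatKernel N t (x - y) * ‖y‖ ^ (-a)
        ≤ ∫ y, (2 ^ a * ‖x‖ ^ (-a) * heatKernel N t (x - y) + k * φ ‖y‖) :=
          integral_mono_of_nonneg (.of_forall hnn) hdom (.of_forall hbound)
      _ = 2 ^ a * ‖x‖ ^ (-a) + k * ∫ y : EuclideanSpace ℝ (Fin N), φ ‖y‖ := by
          rw [integral_add (hG.const_mul _) (hint.const_mul k), integral_const_mul,
            integral_const_mul, integral_sub_left_eq_self (heatKernel N t),
            integral_heatKernel N ht, mul_one]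
      _ ≤ 2 ^ a * ‖x‖ ^ (-a) + k * (B * ‖x‖ ^ ((N : ℝ) - a)) := by gcongr
      _ = 2 ^ a * ‖x‖ ^ (-a) + (k * ‖x‖ ^ ((N : ℝ) - a)) * B := by ring
      _ ≤ 2 ^ a * ‖x‖ ^ (-a) + (P * E * ‖x‖ ^ (-a)) * B := by gcongr
      _ = _ := by ring

/-- Away from the origin, the heat kernel is smaller than its dilation by any power of time. -/
lemma exists_heatKernel_le_rpow_mul (N : ℕ) {q : ℝ} (hq : 0 < q) :
    ∃ C > 0, ∀ t : ℝ, 0 < t → ∀ z : EuclideanSpace ℝ (Fin N), t ^ ((1 : ℝ) / 6) / 2 ≤ ‖z‖ →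
      heatKernel N t z ≤ C * t ^ q * heatKernel N (2 * t) z := by
  set E : ℝ := (3 / 2 * q / (1 / 32)) ^ (3 / 2 * q)
  refine ⟨2 ^ ((N : ℝ) / 2) * E, by positivity, fun t ht z hz ↦ ?_⟩
  have h1 := rpow_mul_exp_neg_le (p := 3 / 2 * q) (c := 1 / 32) (s := t ^ (-(2 : ℝ) / 3))
    (by positivity) (by norm_num) (by positivity)
  have h2 : Real.exp (-(1 / 32 * t ^ (-(2 : ℝ) / 3))) ≤ E * t ^ q := by
    rw [← Real.rpow_mul ht.le, show -(2 : ℝ) / 3 * (3 / 2 * q) = -q by ring,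
      Real.rpow_neg ht.le, inv_mul_le_iff₀ (by positivity)] at h1
    exact h1.trans_eq (mul_comm _ _)
  have h3 : 1 / 32 * t ^ (-(2 : ℝ) / 3) ≤ ‖z‖ ^ 2 / (8 * t) := by
    have h4 : (t ^ ((1 : ℝ) / 6) / 2) ^ 2 ≤ ‖z‖ ^ 2 := by gcongr
    have h5 : (t ^ ((1 : ℝ) / 6)) ^ 2 = t ^ (-(2 : ℝ) / 3) * t := by
      rw [← Real.rpow_natCast, ← Real.rpow_mul ht.le]
      nth_rewrite 3 [← Real.rpow_one t]
      rw [← Real.rpow_add ht]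
      norm_num
    rw [le_div_iff₀ (by positivity)]
    rw [div_pow, h5] at h4
    linarith
  have h6 : heatKernel N t z =
      2 ^ ((N : ℝ) / 2) * Real.exp (-(‖z‖ ^ 2 / (8 * t))) * heatKernel N (2 * t) z := by
    have hc : (4 * Real.pi * t) ^ (-(N : ℝ) / 2) =
        2 ^ ((N : ℝ) / 2) * (4 * Real.pi * (2 * t)) ^ (-(N : ℝ) / 2) := by
      rw [show 4 * Real.pi * (2 * t) = 2 * (4 * Real.pi * t) by ring,
        Real.mul_rpow (x := 2) (by norm_num) (by positivity), ← mul_assoc, ← Real.rpow_add two_pos,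
        show (N : ℝ) / 2 + -N / 2 = 0 by ring, Real.rpow_zero, one_mul]
    have he : -‖z‖ ^ 2 / (4 * t) = -(‖z‖ ^ 2 / (8 * t)) + -‖z‖ ^ 2 / (4 * (2 * t)) := by
      field_simp
      ring
    unfold heatKernel
    rw [hc, he, Real.exp_add]
    ring
  have h7 := heatKernel_nonneg N (mul_pos two_pos ht) z
  rw [h6, mul_assoc _ E]
  gcongr
  exact (Real.exp_le_exp.mpr (neg_le_neg h3)).trans h2

lemma heatSemigroup_nonneg {N : ℕ} {t : ℝ} (ht : 0 < t) {μ : EuclideanSpace ℝ (Fin N) → ℝ}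
    (hμ : ∀ x, 0 ≤ μ x) (x : EuclideanSpace ℝ (Fin N)) : 0 ≤ heatSemigroup N t μ x :=
  integral_nonneg fun y ↦ mul_nonneg (heatKernel_nonneg N ht (x - y)) (hμ y)

lemma heatSemigroup_le_integral {N : ℕ} (hN : 1 ≤ N) {t : ℝ} (ht : 0 < t)
    {μ : EuclideanSpace ℝ (Fin N) → ℝ} (hμ : ∀ x, 0 ≤ μ x) {x : EuclideanSpace ℝ (Fin N)}
    {g : EuclideanSpace ℝ (Fin N) → ℝ} (hg : Integrable g)
    (h : ∀ y ≠ 0, heatKernel N t (x - y) * μ y ≤ g y) : heatSemigroup N t μ x ≤ ∫ y, g y := by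
  have := nontrivial_euclideanSpace_fin hN
  refine integral_mono_of_nonneg
    (.of_forall fun y ↦ mul_nonneg (heatKernel_nonneg N ht (x - y)) (hμ y)) hg ?_
  filter_upwards [Measure.ae_ne volume 0] with y hy using h y hy

/-- Pointwise bounds of the heat flow of data below `‖x‖ ^ (-a) * f ‖x‖`: one everywhere, and a
finer one for `‖x‖ ≤ t ^ (1 / 4)`. -/
lemma exists_heatSemigroup_le {N : ℕ} (hN : 1 ≤ N) {a : ℝ} (ha : 0 < a) (haN : a < N)
    {f : ℝ → ℝ} (hf : MonotoneOn f (Set.Ioc (0 : ℝ) 1)) (hfnn : ∀ r, 0 ≤ f r)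
    {μ : EuclideanSpace ℝ (Fin N) → ℝ} (hμnn : ∀ x, 0 ≤ μ x)
    (hμle : ∀ x : EuclideanSpace ℝ (Fin N), x ≠ 0 → ‖x‖ ≤ 1 → μ x ≤ ‖x‖ ^ (-a) * f ‖x‖)
    (hμ0 : ∀ x : EuclideanSpace ℝ (Fin N), 1 < ‖x‖ → μ x = 0) {q : ℝ} (hq : 0 < q) :
    ∃ D > 0, ∀ t : ℝ, 0 < t → t < (1 / 2) ^ 12 → ∀ x : EuclideanSpace ℝ (Fin N), x ≠ 0 →
      heatSemigroup N t μ x ≤ D * ‖x‖ ^ (-a) ∧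
      (‖x‖ ≤ t ^ ((1 : ℝ) / 4) →
        heatSemigroup N t μ x ≤ D * ‖x‖ ^ (-a) * (f (t ^ ((1 : ℝ) / 6)) + t ^ q)) := by
  obtain ⟨A, hA, hheat⟩ := exists_integral_heatKernel_mul_norm_rpow_neg_le hN ha haN
  obtain ⟨B, hB, hfar⟩ := exists_heatKernel_le_rpow_mul N hq
  have hM := hfnn 1
  have hμM : ∀ y : EuclideanSpace ℝ (Fin N), y ≠ 0 → μ y ≤ f 1 * ‖y‖ ^ (-a) := by
    intro y hy
    have hy0 : 0 < ‖y‖ := norm_pos_iff.mpr hy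
    rcases le_or_gt ‖y‖ 1 with h | h
    · rw [mul_comm]
      refine (hμle y hy h).trans ?_
      gcongr
      exact hf ⟨hy0, h⟩ ⟨one_pos, le_rfl⟩ h
    · rw [hμ0 y h]
      positivity
  refine ⟨A * (1 + f 1 + f 1 * B), by positivity, fun t ht ht0 x hx ↦ ⟨?_, fun hxt ↦ ?_⟩⟩
  · obtain ⟨hint, hle⟩ := hheat t ht x hx
    calc heatSemigroup N t μ x
        ≤ ∫ y, f 1 * (heatKernel N t (x - y) * ‖y‖ ^ (-a)) := by
          refine heatSemigroup_le_integral hN ht hμnn (hint.const_mul _) fun y hy ↦ ?_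
          have := mul_le_mul_of_nonneg_left (hμM y hy) (heatKernel_nonneg N ht (x - y))
          linarith
      _ ≤ f 1 * (A * ‖x‖ ^ (-a)) := by rw [integral_const_mul]; gcongr
      _ = A * (f 1) * ‖x‖ ^ (-a) := by ring
      _ ≤ _ := by gcongr; nlinarith
  · have ht2 : 0 < 2 * t := by positivity
    obtain ⟨hint, hle⟩ := hheat t ht x hx
    obtain ⟨hint2, hle2⟩ := hheat (2 * t) ht2 x hx
    have ht1 : t ≤ 1 := ht0.le.trans (by norm_num)
    set ρ := t ^ ((1 : ℝ) / 6)
    have hρ : 0 < ρ := by positivity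
    have hρ1 : ρ ≤ 1 := Real.rpow_le_one ht.le ht1 (by norm_num)
    have hxρ : ‖x‖ ≤ ρ / 2 := by
      have h1 : t ^ ((1 : ℝ) / 4) = ρ * t ^ ((1 : ℝ) / 12) := by
        rw [← Real.rpow_add ht]; norm_num
      have h2 : t ^ ((1 : ℝ) / 12) ≤ 1 / 2 := by
        calc t ^ ((1 : ℝ) / 12) ≤ ((1 / 2) ^ 12) ^ ((1 : ℝ) / 12) := by gcongr
          _ = 1 / 2 := by
            rw [← Real.rpow_natCast, ← Real.rpow_mul (by norm_num)]; norm_num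
      have := mul_le_mul_of_nonneg_left h2 hρ.le
      linarith
    have hF := hfnn ρ
    have hτ : 0 < t ^ q := by positivity
    have hbound : ∀ y ≠ 0, heatKernel N t (x - y) * μ y ≤
        f ρ * (heatKernel N t (x - y) * ‖y‖ ^ (-a)) +
          f 1 * (B * t ^ q) * (heatKernel N (2 * t) (x - y) * ‖y‖ ^ (-a)) := by
      intro y hy
      have hy0 : 0 < ‖y‖ := norm_pos_iff.mpr hy
      have hG := heatKernel_nonneg N ht (x - y)
      have hG2 := heatKernel_nonneg N ht2 (x - y)
      rcases le_or_gt ‖y‖ ρ with h | h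
      · have h1 : μ y ≤ f ρ * ‖y‖ ^ (-a) := by
          rw [mul_comm]
          refine (hμle y hy (h.trans hρ1)).trans ?_
          gcongr
          exact hf ⟨hy0, h.trans hρ1⟩ ⟨hρ, hρ1⟩ h
        have h2 := mul_le_mul_of_nonneg_left h1 hG
        have : 0 ≤ f 1 * (B * t ^ q) * (heatKernel N (2 * t) (x - y) * ‖y‖ ^ (-a)) := by
          positivity
        linarith
      · have hz : ρ / 2 ≤ ‖x - y‖ := by
          have := norm_sub_norm_le y x
          rw [norm_sub_rev] at this
          linarith
        have h1 : heatKernel N t (x - y) * μ y ≤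
            (B * t ^ q * heatKernel N (2 * t) (x - y)) * (f 1 * ‖y‖ ^ (-a)) :=
          mul_le_mul (hfar t ht _ hz) (hμM y hy) (hμnn y) (by positivity)
        have : 0 ≤ f ρ * (heatKernel N t (x - y) * ‖y‖ ^ (-a)) := by positivity
        linarith
    calc heatSemigroup N t μ x
        ≤ ∫ y, (f ρ * (heatKernel N t (x - y) * ‖y‖ ^ (-a)) +
            f 1 * (B * t ^ q) * (heatKernel N (2 * t) (x - y) * ‖y‖ ^ (-a))) :=
          heatSemigroup_le_integral hN ht hμnn ((hint.const_mul _).add (hint2.const_mul _)) hbound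
      _ ≤ f ρ * (A * ‖x‖ ^ (-a)) + f 1 * (B * t ^ q) * (A * ‖x‖ ^ (-a)) := by
          rw [integral_add (hint.const_mul _) (hint2.const_mul _), integral_const_mul,
            integral_const_mul]
          gcongr
      _ = A * ‖x‖ ^ (-a) * (1 * f ρ + f 1 * B * t ^ q) := by ring
      _ ≤ A * ‖x‖ ^ (-a) * ((1 + f 1 + f 1 * B) * f ρ + (1 + f 1 + f 1 * B) * t ^ q) := by
          have : 0 ≤ f 1 * B := by positivity
          gcongr <;> linarith
      _ = _ := by ring

theorem annulus_Lr_estimate (N : ℕ) (hN : 1 ≤ N) (a : ℝ) (ha : 0 < a) (haN : a < N)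
    (f : ℝ → ℝ) (hf : MonotoneOn f (Set.Ioc (0:ℝ) 1)) (hfnn : ∀ r, 0 ≤ f r)
    (μ : EuclideanSpace ℝ (Fin N) → ℝ) (hμmeas : Measurable μ) (hμnn : ∀ x, 0 ≤ μ x)
    (hμle : ∀ x : EuclideanSpace ℝ (Fin N), x ≠ 0 → ‖x‖ ≤ 1 →
      μ x ≤ ‖x‖ ^ (-a) * f ‖x‖)
    (hμ0 : ∀ x : EuclideanSpace ℝ (Fin N), 1 < ‖x‖ → μ x = 0)
    (r : ℝ) (hr : (N : ℝ) / a < r) :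
    ∃ C > 0, ∃ t₀ ∈ Set.Ioo (0:ℝ) 1, ∀ t : ℝ, 0 < t → t < t₀ →
      (∫ x in Metric.ball (0 : EuclideanSpace ℝ (Fin N)) 1 \
            Metric.ball 0 (Real.sqrt t), (heatSemigroup N t μ x) ^ r) ^ (1 / r)
        ≤ C * t ^ (-(N : ℝ) / 2 * (a / N - 1 / r)) *
            (f (t ^ ((1:ℝ) / 6)) + t ^ ((a * r - N) / (4 * r))) := by
  have hN0 : (0 : ℝ) < N := by exact_mod_cast hN
  have hr0 : 0 < r := lt_trans (by positivity) hr
  have hK : (N : ℝ) < a * r := by rwa [div_lt_iff₀' ha] at hr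
  set q : ℝ := (a * r - N) / (4 * r) with hqdef
  have hq : 0 < q := div_pos (by linarith) (by positivity)
  obtain ⟨D, hD, hpt⟩ := exists_heatSemigroup_le hN ha haN hf hfnn hμnn hμle hμ0 hq
  obtain ⟨Q, hQ, hout⟩ := exists_integral_compl_ball_norm_rpow_neg hN hK
  refine ⟨(2 * Q) ^ (1 / r) * D, by positivity, (1 / 2) ^ 12, by norm_num, fun t ht ht0 ↦ ?_⟩
  set T := f (t ^ ((1 : ℝ) / 6)) + t ^ q with hTdef
  have hτ : 0 < t ^ q := by positivity
  have hτT : t ^ q ≤ T := le_add_of_nonneg_left (hfnn _)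
  have hT : 0 < T := hτ.trans_le hτT
  have hs : 0 < Real.sqrt t := Real.sqrt_pos.mpr ht
  have ht4 : 0 < t ^ ((1 : ℝ) / 4) := by positivity
  obtain ⟨hi1, hl1⟩ := hout _ hs
  obtain ⟨hi2, hl2⟩ := hout _ ht4
  set φ := (Set.Ici (Real.sqrt t)).indicator (fun s : ℝ ↦ s ^ (-(a * r)))
  set ψ := (Set.Ici (t ^ ((1 : ℝ) / 4))).indicator (fun s : ℝ ↦ s ^ (-(a * r)))
  set S := Metric.ball (0 : EuclideanSpace ℝ (Fin N)) 1 \ Metric.ball 0 (Real.sqrt t)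
  have hφ : ∀ x : EuclideanSpace ℝ (Fin N), 0 ≤ φ ‖x‖ := fun x ↦
    Set.indicator_apply_nonneg fun _ ↦ by positivity
  have hψ : ∀ x : EuclideanSpace ℝ (Fin N), 0 ≤ ψ ‖x‖ := fun x ↦
    Set.indicator_apply_nonneg fun _ ↦ by positivity
  have hdom := (hi1.const_mul (D ^ r * T ^ r)).add (hi2.const_mul (D ^ r))
  have hbound : ∀ x ∈ S, (heatSemigroup N t μ x) ^ r ≤
      D ^ r * T ^ r * φ ‖x‖ + D ^ r * ψ ‖x‖ := by
    intro x hx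
    have hxs : Real.sqrt t ≤ ‖x‖ := by simpa using hx.2
    have hx0 : 0 < ‖x‖ := hs.trans_le hxs
    have hu := heatSemigroup_nonneg ht hμnn x
    obtain ⟨h1, h2⟩ := hpt t ht ht0 x (norm_pos_iff.mp hx0)
    have hpow : (‖x‖ ^ (-a)) ^ r = ‖x‖ ^ (-(a * r)) := by
      rw [← Real.rpow_mul hx0.le, neg_mul]
    rcases le_or_gt ‖x‖ (t ^ ((1 : ℝ) / 4)) with h | h
    · have hφx : φ ‖x‖ = ‖x‖ ^ (-(a * r)) := Set.indicator_of_mem hxs _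
      have h3 := Real.rpow_le_rpow hu (h2 h) hr0.le
      rw [Real.mul_rpow (by positivity) hT.le, Real.mul_rpow hD.le (by positivity), hpow] at h3
      have := mul_nonneg (Real.rpow_nonneg hD.le r) (hψ x)
      rw [hφx]
      linarith
    · have hψx : ψ ‖x‖ = ‖x‖ ^ (-(a * r)) := Set.indicator_of_mem h.le _
      have h3 := Real.rpow_le_rpow hu h1 hr0.le
      rw [Real.mul_rpow hD.le (by positivity), hpow] at h3
      have : 0 ≤ D ^ r * T ^ r * φ ‖x‖ := mul_nonneg (by positivity) (hφ x)
      rw [hψx]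
      linarith
  have hS : MeasurableSet S := measurableSet_ball.diff measurableSet_ball
  have hpow1 : Real.sqrt t ^ ((N : ℝ) - a * r) = t ^ (-(2 * q * r)) := by
    rw [Real.sqrt_eq_rpow, ← Real.rpow_mul ht.le, hqdef]
    congr 1
    field_simp
    ring
  have hpow2 : (t ^ ((1 : ℝ) / 4)) ^ ((N : ℝ) - a * r) = t ^ (-(2 * q * r)) * (t ^ q) ^ r := by
    rw [← Real.rpow_mul ht.le, ← Real.rpow_mul ht.le, ← Real.rpow_add ht, hqdef]
    congr 1
    field_simp
    ring
  have hmain : ∫ x in S, (heatSemigroup N t μ x) ^ r ≤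
      2 * Q * D ^ r * t ^ (-(2 * q * r)) * T ^ r := by
    calc ∫ x in S, (heatSemigroup N t μ x) ^ r
        ≤ ∫ x in S, (D ^ r * T ^ r * φ ‖x‖ + D ^ r * ψ ‖x‖) :=
          integral_mono_of_nonneg
            (.of_forall fun x ↦ Real.rpow_nonneg (heatSemigroup_nonneg ht hμnn x) r)
            hdom.integrableOn (ae_restrict_of_forall_mem hS hbound)
      _ ≤ ∫ x : EuclideanSpace ℝ (Fin N), (D ^ r * T ^ r * φ ‖x‖ + D ^ r * ψ ‖x‖) :=
          setIntegral_le_integral hdom (.of_forall fun x ↦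
            add_nonneg (mul_nonneg (by positivity) (hφ x)) (mul_nonneg (by positivity) (hψ x)))
      _ ≤ D ^ r * T ^ r * (Q * Real.sqrt t ^ ((N : ℝ) - a * r)) +
            D ^ r * (Q * (t ^ ((1 : ℝ) / 4)) ^ ((N : ℝ) - a * r)) := by
          rw [integral_add (hi1.const_mul _) (hi2.const_mul _), integral_const_mul,
            integral_const_mul]
          gcongr
      _ ≤ D ^ r * T ^ r * (Q * t ^ (-(2 * q * r))) +
            D ^ r * (Q * (t ^ (-(2 * q * r)) * T ^ r)) := by
          rw [hpow1, hpow2]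
          gcongr
      _ = _ := by ring
  calc (∫ x in S, (heatSemigroup N t μ x) ^ r) ^ (1 / r)
      ≤ (2 * Q * D ^ r * t ^ (-(2 * q * r)) * T ^ r) ^ (1 / r) :=
        Real.rpow_le_rpow
          (integral_nonneg fun x ↦ Real.rpow_nonneg (heatSemigroup_nonneg ht hμnn x) r)
          hmain (by positivity)
    _ = _ := by
        rw [Real.mul_rpow (by positivity) (by positivity),
          Real.mul_rpow (by positivity) (by positivity),
          Real.mul_rpow (by positivity) (by positivity), one_div,
          Real.rpow_rpow_inv hD.le hr0.ne', Real.rpow_rpow_inv hT.le hr0.ne',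
          ← Real.rpow_mul ht.le]
        congr 3
        rw [hqdef]
        field_simp
        ring
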